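/- Let G be a group admitting an RFRS sequence G = G_0 ≥ G_1 ≥ G_2 ≥ ⋯, and let g_1, …, g_n ∈ G be finitely many elements, each different from the identity. Then there exists a single index i and positive integers k_1, …, k_n such that for every j ∈ {1, …, n}: the power g_j^{k_j} lies in G_i, the power g_j^{k_j} is not the identity, and (g_j^{k_j})^m ∉ [G_i, G_i] for every nonzero integer m (that is, each g_j^{k_j} represents a non-torsion element of the abelianization G_i/[G_i,G_i]). -/

import Mathlib

/-- `Gs` is an RFRS sequence of subgroups of `G`. -/
def IsRFRSSeq {G : Type*} [Group G] (Gs : ℕ → Subgroup G) : Prop :=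
  Gs 0 = ⊤ ∧
  (∀ i, Gs (i + 1) ≤ Gs i) ∧
  (∀ i, (Gs i).Normal) ∧
  (∀ i, (Gs i).FiniteIndex) ∧
  (⨅ i, Gs i) = ⊥ ∧
  (∀ i, ∀ x ∈ Gs i, (∃ k : ℤ, k ≠ 0 ∧ x ^ k ∈ ⁅Gs i, Gs i⁆) → x ∈ Gs (i + 1))

/-- A nontrivial element of a group with an RFRS sequence has, from some stage on, no nonzero power
in the commutator subgroup of a term of the sequence. -/
theorem IsRFRSSeq.exists_zpow_notMem_commutator {G : Type*} [Group G] {Gs : ℕ → Subgroup G}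
    (hGs : IsRFRSSeq Gs) {x : G} (hx : x ≠ 1) :
    ∃ i, ∀ i' ≥ i, ∀ m : ℤ, m ≠ 0 → x ^ m ∉ ⁅Gs i', Gs i'⁆ := by
  obtain ⟨h_zero, h_succ, -, -, h_inf, h_rat⟩ := hGs
  by_contra! h
  refine hx ?_
  have h_mem : ∀ i, x ∈ Gs i := by
    intro i
    induction i with
    | zero => simp [h_zero]
    | succ i ih =>
      obtain ⟨i', hi', m, hm, hxm⟩ := h i
      have h_le : Gs i' ≤ Gs i := antitone_nat_of_succ_le h_succ hi'
      exact h_rat i x ih ⟨m, hm, Subgroup.commutator_mono h_le h_le hxm⟩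
  have : x ∈ ⨅ i, Gs i := Subgroup.mem_iInf.mpr h_mem
  rwa [h_inf, Subgroup.mem_bot] at this

/-- Given finitely many nontrivial elements `g 1, …, g n` of an RFRS group `G`,
there is a single index `i` and positive powers `g j ^ k j` which all lie in
`Gs i`, are nontrivial, and represent non-torsion elements of the
abelianization of `Gs i`. -/
theorem stmt9 (G : Type*) [Group G] (Gs : ℕ → Subgroup G) (hGs : IsRFRSSeq Gs)
    (n : ℕ) (g : Fin n → G) (hg : ∀ j, g j ≠ 1) :
    ∃ i, ∃ k : Fin n → ℕ, ∀ j,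
      0 < k j ∧ g j ^ k j ∈ Gs i ∧ g j ^ k j ≠ 1 ∧
      ∀ m : ℤ, m ≠ 0 → (g j ^ k j) ^ m ∉ ⁅Gs i, Gs i⁆ := by
  choose N hN using fun j => hGs.exists_zpow_notMem_commutator (hg j)
  obtain ⟨-, -, h_normal, h_index, -, -⟩ := hGs
  set i := Finset.univ.sup N
  have := h_normal i
  have := h_index i
  have h_pos : 0 < (Gs i).index := Nat.pos_of_ne_zero Subgroup.FiniteIndex.index_ne_zero
  have h_notMem : ∀ j, ∀ m : ℤ, m ≠ 0 → (g j ^ (Gs i).index) ^ m ∉ ⁅Gs i, Gs i⁆ := by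
    intro j m hm
    rw [← zpow_natCast, ← zpow_mul]
    exact hN j i (Finset.le_sup (Finset.mem_univ j)) _
      (mul_ne_zero (Nat.cast_ne_zero.mpr h_pos.ne') hm)
  refine ⟨i, fun _ => (Gs i).index, fun j =>
    ⟨h_pos, Subgroup.pow_index_mem (Gs i) (g j), fun h => h_notMem j 1 one_ne_zero ?_, h_notMem j⟩⟩
  rw [h, one_zpow]
  exact one_mem _
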